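/- Let X ⊆ S^{ℤ²} be a downward deterministic subshift and let Y ⊆ S^{ℤ²} be a subshift containing at least 2 points. Then the universal extension A(X,Y) is downward deterministic. -/

import Mathlib

namespace QE

/-- A finite pattern over the alphabet `S` on the group of positions `V`:
a finite domain `D ⊆ V` together with an assignment of symbols to `D`. -/
def Pattern (V S : Type*) : Type _ :=
  Σ D : Finset V, {v : V // v ∈ D} → S

variable {V S T : Type*}

/-- The pattern `P` occurs in the configuration `x` (at some translate). -/
def occursIn [Add V] (P : Pattern V S) (x : V → S) : Prop :=
  ∃ t : V, ∀ w : {v : V // v ∈ P.1}, x (t + w.1) = P.2 w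

/-- The subshift defined by the set `F` of forbidden patterns. -/
def shiftOf [Add V] (F : Set (Pattern V S)) : Set (V → S) :=
  {x | ∀ P ∈ F, ¬ occursIn P x}

/-- `X` is a subshift: it is defined by some set of forbidden patterns. -/
def IsSubshift [Add V] (X : Set (V → S)) : Prop :=
  ∃ F : Set (Pattern V S), X = shiftOf F

/-- `X` is a subshift of finite type: defined by a finite set of forbidden patterns. -/
def IsSFT [Add V] (X : Set (V → S)) : Prop :=
  ∃ F : Set (Pattern V S), F.Finite ∧ X = shiftOf F

/-- The language of `X`: all finite patterns occurring in some configuration of `X`. -/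
def lang [Add V] (X : Set (V → S)) : Set (Pattern V S) :=
  {P | ∃ x ∈ X, occursIn P x}

/-- `φ` acts on `Z` as a block map: it is given by a local function on a finite neighborhood. -/
def IsBlockMapOn [Add V] (Z : Set (V → S)) (φ : (V → S) → V → T) : Prop :=
  ∃ (D : Finset V) (Φ : ({v : V // v ∈ D} → S) → T),
    ∀ x ∈ Z, ∀ t : V, φ x t = Φ fun w => x (t + w.1)

/-- `X` is a sofic shift: the image of an SFT (over some finite alphabet) under a block map. -/
def IsSofic [Add V] (X : Set (V → S)) : Prop :=
  ∃ (T' : Type) (_ : Fintype T') (Z : Set (V → T')) (φ : (V → T') → V → S),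
    IsSFT Z ∧ IsBlockMapOn Z φ ∧ φ '' Z = X

/-- `X` is a countably covered sofic shift: the image of a countable SFT under a block map. -/
def IsCountablyCovered [Add V] (X : Set (V → S)) : Prop :=
  ∃ (T' : Type) (_ : Fintype T') (Z : Set (V → T')) (φ : (V → T') → V → S),
    IsSFT Z ∧ Z.Countable ∧ IsBlockMapOn Z φ ∧ φ '' Z = X

/-- Fill the holes (`none`-symbols) of the pattern `P` using the pattern `Q`:
this is `P^{(Q)}`. -/
def fill (P : Pattern V (Option S)) (Q : {v : V // v ∈ P.1} → S) : Pattern V S :=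
  ⟨P.1, fun w => (P.2 w).getD (Q w)⟩

/-- The universal extension `A(X,Y)`, a subshift over the alphabet `Option S`
(`none` playing the role of the hole symbol `□`). -/
def univExt [Add V] (X Y : Set (V → S)) : Set (V → Option S) :=
  shiftOf {P : Pattern V (Option S) |
    ∃ Q : {v : V // v ∈ P.1} → S, (⟨P.1, Q⟩ : Pattern V S) ∈ lang Y ∧ fill P Q ∉ lang X}

/-- The existential extension `E(X,Y)`, a subshift over the alphabet `Option S`
(`none` playing the role of the hole symbol `□`). -/
def existExt [Add V] (X Y : Set (V → S)) : Set (V → Option S) :=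
  shiftOf {P : Pattern V (Option S) |
    ∀ Q : {v : V // v ∈ P.1} → S, (⟨P.1, Q⟩ : Pattern V S) ∈ lang Y → fill P Q ∉ lang X}


/-- A two-dimensional subshift is downward deterministic if the contents of the open
upper half-plane `{(a,b) : b > 0}` determine the symbol at the origin. -/
def DownDet {S : Type*} (X : Set ((ℤ × ℤ) → S)) : Prop :=
  ∀ x ∈ X, ∀ y ∈ X, (∀ v : ℤ × ℤ, 0 < v.2 → x v = y v) → x (0, 0) = y (0, 0)

/-- Filling the holes of a configuration of the universal extension by a point of `Y`
gives a point of `X`. -/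
lemma getD_mem_of_mem_univExt [Add V] {X Y : Set (V → S)} (hX : IsSubshift X)
    {x : V → Option S} (hx : x ∈ univExt X Y) {y : V → S} (hy : y ∈ Y) :
    (fun v => (x v).getD (y v)) ∈ X := by
  obtain ⟨F, rfl⟩ := hX
  rintro P hP ⟨t, ht⟩
  refine hx ⟨P.1, fun w => x (t + w.1)⟩ ⟨fun w => y (t + w.1), ⟨y, hy, t, fun _ => rfl⟩, ?_⟩
    ⟨t, fun _ => rfl⟩
  rintro ⟨z, hz, u, hu⟩
  exact hz P hP ⟨u, fun w => (hu w).trans (ht w)⟩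

/-- Subshifts are invariant under translations. -/
lemma IsSubshift.translate_mem [AddSemigroup V] {Y : Set (V → S)} (hY : IsSubshift Y)
    {y : V → S} (hy : y ∈ Y) (u : V) : (fun v => y (u + v)) ∈ Y := by
  obtain ⟨F, rfl⟩ := hY
  rintro P hP ⟨t, ht⟩
  exact hy P hP ⟨u + t, fun w => by rw [add_assoc]; exact ht w⟩

/-- In a subshift with at least two points, no symbol is forced at the identity position. -/
lemma IsSubshift.exists_apply_zero_ne [AddMonoid V] {Y : Set (V → S)} (hY : IsSubshift Y)
    (hY2 : ∃ y₁ ∈ Y, ∃ y₂ ∈ Y, y₁ ≠ y₂) (s : S) : ∃ y ∈ Y, y 0 ≠ s := by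
  by_contra! h
  obtain ⟨y₁, h₁, y₂, h₂, hne⟩ := hY2
  refine hne (funext fun v => ?_)
  have e₁ := h _ (hY.translate_mem h₁ v)
  have e₂ := h _ (hY.translate_mem h₂ v)
  simp only [add_zero] at e₁ e₂
  rw [e₁, e₂]

/-- If `X ⊆ S^{ℤ²}` is a downward deterministic subshift and `Y ⊆ S^{ℤ²}`
is a subshift with at least two points, then the universal extension `A(X,Y)` is downward
deterministic. -/
theorem stmt17 (S : Type) [Fintype S] (X Y : Set ((ℤ × ℤ) → S))
    (hXsub : IsSubshift X) (hYsub : IsSubshift Y) (hXdet : DownDet X)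
    (hY2 : ∃ y₁ ∈ Y, ∃ y₂ ∈ Y, y₁ ≠ y₂) :
    DownDet (univExt X Y) := by
  intro x hx x' hx' hagree
  have key : ∀ y ∈ Y, (x (0, 0)).getD (y (0, 0)) = (x' (0, 0)).getD (y (0, 0)) := fun y hy =>
    hXdet _ (getD_mem_of_mem_univExt hXsub hx hy) _ (getD_mem_of_mem_univExt hXsub hx' hy)
      fun v hv => by simp only [hagree v hv]
  rcases hx0 : x (0, 0) with _ | a <;> rcases hx0' : x' (0, 0) with _ | b <;>
    simp only [hx0, hx0', Option.getD_none, Option.getD_some] at key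
  · rfl
  · obtain ⟨y, hy, hne⟩ := hYsub.exists_apply_zero_ne hY2 b
    exact absurd (key y hy) hne
  · obtain ⟨y, hy, hne⟩ := hYsub.exists_apply_zero_ne hY2 a
    exact absurd (key y hy).symm hne
  · obtain ⟨y, hy, -⟩ := hY2
    rw [key y hy]

end QE
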